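/- arXiv:2508.04627 — 2 statements merged into one kernel-verified Lean document; each statement's English description precedes it below -/
import Mathlib

section
/- (Proposition 1, matrix form.) Let A, B, C be complex matrices with A Hermitian p×p, B of size p×q, and C Hermitian positive definite q×q, and suppose the Schur complement S := A − B C⁻¹ Bᴴ is positive definite. Then trace(S⁻¹) equals the minimum of trace(Ξ⁻¹) over all Hermitian positive definite p×p matrices Ξ such that the block matrix [[A − Ξ, B],[Bᴴ, C]] is positive semidefinite. Concretely: (i) for every such feasible Ξ, trace(S⁻¹) ≤ trace(Ξ⁻¹); and (ii) Ξ = S is feasible, i.e., [[A − S, B],[Bᴴ, C]] is positive semidefinite. -/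
open Matrix
open scoped ComplexOrder

/-- Proposition 1 (matrix form): with `A` Hermitian, `C` positive definite, and
`S = A − B C⁻¹ Bᴴ` positive definite, `trace (S⁻¹)` is the minimum of `trace (Ξ⁻¹)`
over Hermitian positive definite `Ξ` with `[[A − Ξ, B],[Bᴴ, C]]` positive semidefinite:
(i) every feasible `Ξ` satisfies `trace (S⁻¹) ≤ trace (Ξ⁻¹)`, and (ii) `Ξ = S` is
feasible. -/
theorem schur_trace_inv_min {p q : ℕ}
    (A : Matrix (Fin p) (Fin p) ℂ) (B : Matrix (Fin p) (Fin q) ℂ)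
    (C : Matrix (Fin q) (Fin q) ℂ)
    (hA : A.IsHermitian) (hC : C.PosDef)
    (hS : (A - B * C⁻¹ * Bᴴ).PosDef) :
    (∀ Ξ : Matrix (Fin p) (Fin p) ℂ, Ξ.PosDef →
        (Matrix.fromBlocks (A - Ξ) B Bᴴ C).PosSemidef →
        (((A - B * C⁻¹ * Bᴴ)⁻¹).trace).re ≤ ((Ξ⁻¹).trace).re) ∧
      (Matrix.fromBlocks (A - (A - B * C⁻¹ * Bᴴ)) B Bᴴ C).PosSemidef := by
  have : Invertible C := hC.isUnit.invertible
  constructor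
  · intro Ξ hΞ h
    rw [Matrix.PosDef.fromBlocks₂₂ _ _ hC] at h
    generalize hT : A - B * C⁻¹ * Bᴴ = S at *
    have h1 : (S - Ξ).PosSemidef := by
      rw [← hT, sub_right_comm]
      exact h
    have : Invertible Ξ := hΞ.isUnit.invertible
    have : Invertible S := hS.isUnit.invertible
    have hΞi : (Ξ⁻¹).PosDef := hΞ.inv
    have : Invertible (Ξ⁻¹) := hΞi.isUnit.invertible
    have h2 : (Matrix.fromBlocks S 1 (1 : Matrix (Fin p) (Fin p) ℂ)ᴴ Ξ⁻¹).PosSemidef := by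
      rw [Matrix.PosDef.fromBlocks₂₂ _ _ hΞi]
      simpa using h1
    rw [Matrix.PosDef.fromBlocks₁₁ _ _ hS] at h2
    have h3 : (Ξ⁻¹ - S⁻¹).PosSemidef := by simpa using h2
    have h4 := (Complex.le_def.1 h3.trace_nonneg).1
    simpa [Matrix.trace_sub] using h4
  · rw [Matrix.PosDef.fromBlocks₂₂ _ _ hC]
    simpa using (Matrix.PosSemidef.zero : (0 : Matrix (Fin p) (Fin p) ℂ).PosSemidef)
end

section
/- Let T_A be an N×R complex matrix with T_Aᴴ T_A = c · I_R for some c > 0, let W be an N×K complex matrix with M := T_Aᴴ W ≠ 0, and let r > 0. Then T_D⋆ := (r/‖M‖_F) · M minimizes ‖W − T_A T_D‖_F over all R×K complex matrices T_D with ‖T_D‖_F = r: for every T_D with ‖T_D‖_F = r, ‖W − T_A T_D⋆‖_F ≤ ‖W − T_A T_D‖_F (and ‖T_D⋆‖_F = r). -/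
open Matrix

/-- The Frobenius norm of a complex matrix. -/
noncomputable def frobNorm {α β : Type*} [Fintype α] [Fintype β]
    (M : Matrix α β ℂ) : ℝ :=
  Real.sqrt (∑ i, ∑ j, ‖M i j‖ ^ 2)

lemma frobNorm_nonneg' {α β : Type*} [Fintype α] [Fintype β]
    (A : Matrix α β ℂ) : 0 ≤ frobNorm A := Real.sqrt_nonneg _

lemma frobNorm_sq' {α β : Type*} [Fintype α] [Fintype β]
    (A : Matrix α β ℂ) : frobNorm A ^ 2 = (trace (Aᴴ * A)).re := by
  unfold frobNorm
  rw [Real.sq_sqrt (by positivity), Finset.sum_comm]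
  simp only [trace, diag_apply, mul_apply, conjTranspose_apply, Complex.re_sum]
  refine Finset.sum_congr rfl fun i _ => Finset.sum_congr rfl fun j _ => ?_
  rw [← Complex.normSq_eq_norm_sq, Complex.normSq_apply]
  simp

lemma frobNorm_sub_sq' {α β : Type*} [Fintype α] [Fintype β]
    (A B : Matrix α β ℂ) :
    frobNorm (A - B) ^ 2 = frobNorm A ^ 2 - 2 * (trace (Aᴴ * B)).re + frobNorm B ^ 2 := by
  have h : (trace (Bᴴ * A)).re = (trace (Aᴴ * B)).re := by
    have : Bᴴ * A = (Aᴴ * B)ᴴ := by simp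
    rw [this, trace_conjTranspose]
    simp
  simp only [frobNorm_sq', conjTranspose_sub, Matrix.sub_mul, Matrix.mul_sub, trace_sub,
    Complex.sub_re, h]
  ring

lemma frobNorm_smul' {α β : Type*} [Fintype α] [Fintype β] (t : ℝ) (ht : 0 ≤ t)
    (A : Matrix α β ℂ) : frobNorm ((t : ℂ) • A) = t * frobNorm A := by
  unfold frobNorm
  simp only [Matrix.smul_apply, smul_eq_mul, norm_mul, mul_pow, ← Finset.mul_sum]
  rw [Real.sqrt_mul (by positivity), Real.sqrt_sq (norm_nonneg _)]
  simp [abs_of_nonneg ht]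

lemma frobNorm_pos' {α β : Type*} [Fintype α] [Fintype β]
    (A : Matrix α β ℂ) (hA : A ≠ 0) : 0 < frobNorm A := by
  refine lt_of_le_of_ne (frobNorm_nonneg' A) fun h => hA ?_
  have h2 := frobNorm_sq' A
  have h3 : ∑ i, ∑ j, ‖A i j‖ ^ 2 = 0 :=
    (Real.sqrt_eq_zero (by positivity)).1 h.symm
  ext i j
  rw [Finset.sum_eq_zero_iff_of_nonneg (fun i _ => by positivity)] at h3
  have h4 := h3 i (Finset.mem_univ _)
  rw [Finset.sum_eq_zero_iff_of_nonneg (fun i _ => by positivity)] at h4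
  simpa using h4 j (Finset.mem_univ _)

/-- Closed-form digital precoder under a Frobenius-norm power constraint: with
`T_Aᴴ T_A = c • I` (`c > 0`) and `M := T_Aᴴ W ≠ 0`, the matrix
`T_D⋆ = (r / ‖M‖_F) • M` has Frobenius norm `r` and minimizes `‖W − T_A T_D‖_F`
over all `T_D` with `‖T_D‖_F = r`. -/
theorem projection_digital_precoder {N R K : ℕ} (c : ℝ) (hc : 0 < c)
    (T_A : Matrix (Fin N) (Fin R) ℂ)
    (hTA : T_Aᴴ * T_A = (c : ℂ) • (1 : Matrix (Fin R) (Fin R) ℂ))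
    (W : Matrix (Fin N) (Fin K) ℂ) (hM : T_Aᴴ * W ≠ 0)
    (r : ℝ) (hr : 0 < r) :
    frobNorm (((r / frobNorm (T_Aᴴ * W) : ℝ) : ℂ) • (T_Aᴴ * W)) = r ∧
      ∀ T_D : Matrix (Fin R) (Fin K) ℂ, frobNorm T_D = r →
        frobNorm (W - T_A * (((r / frobNorm (T_Aᴴ * W) : ℝ) : ℂ) • (T_Aᴴ * W))) ≤
          frobNorm (W - T_A * T_D) := by
  set M := T_Aᴴ * W with hMdef
  have hm : 0 < frobNorm M := frobNorm_pos' M hM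
  have hnorm : frobNorm (((r / frobNorm M : ℝ) : ℂ) • M) = r := by
    rw [frobNorm_smul' _ (by positivity)]
    field_simp
  refine ⟨hnorm, fun D hD => ?_⟩
  have key : ∀ X : Matrix (Fin R) (Fin K) ℂ, frobNorm (W - T_A * X) ^ 2 =
      frobNorm W ^ 2 - 2 * (trace (Mᴴ * X)).re + c * frobNorm X ^ 2 := by
    intro X
    have h1 : Wᴴ * (T_A * X) = Mᴴ * X := by
      simp [hMdef, Matrix.mul_assoc]
    have h2 : (T_A * X)ᴴ * (T_A * X) = (c : ℂ) • (Xᴴ * X) := by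
      rw [conjTranspose_mul, Matrix.mul_assoc, ← Matrix.mul_assoc T_Aᴴ, hTA]
      simp
    rw [frobNorm_sub_sq', h1, frobNorm_sq' (T_A * X), h2, frobNorm_sq' X]
    simp [trace_smul]
  have hcs : (trace (Mᴴ * D)).re ≤ frobNorm M * r := by
    have h := frobNorm_sub_sq' M (((frobNorm M / r : ℝ) : ℂ) • D)
    rw [frobNorm_smul' _ (by positivity), hD, Matrix.mul_smul, trace_smul, smul_eq_mul,
      Complex.re_ofReal_mul, div_mul_cancel₀ _ hr.ne'] at h
    have h0 := sq_nonneg (frobNorm (M - ((frobNorm M / r : ℝ) : ℂ) • D))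
    have h5 : frobNorm M / r * (trace (Mᴴ * D)).re ≤ frobNorm M / r * (frobNorm M * r) := by
      have : frobNorm M / r * (frobNorm M * r) = frobNorm M ^ 2 := by field_simp
      rw [this]; linarith
    exact le_of_mul_le_mul_left h5 (by positivity)
  have heq : (trace (Mᴴ * (((r / frobNorm M : ℝ) : ℂ) • M))).re = frobNorm M * r := by
    rw [Matrix.mul_smul, trace_smul, smul_eq_mul, Complex.re_ofReal_mul, ← frobNorm_sq']
    field_simp
  refine (sq_le_sq₀ (frobNorm_nonneg' _) (frobNorm_nonneg' _)).1 ?_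
  rw [key, key, hnorm, hD, heq]
  linarith
end
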